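/- arXiv:2002.07131 — 2 statements merged into one kernel-verified Lean document; each statement's English description precedes it below -/
import Mathlib

section
/- Let σ > 0 and set n̄ = n/(n−1) for an integer n ≥ 2. Suppose Λ > π/√(n̄σ). Then there exist constants ω > 0 and L ∈ (0, Λ), a constant Y₀ with Y₀² > ω/4, a constant c > 0, and a smooth function Y : (0,∞) → [0,∞) such that: Y = 0 on a neighborhood of [Λ,∞); Y = Y₀ on a neighborhood of (0,L]; and (n̄σ̄ω/(1+ω))·L² + Y(t)² − L·|Y'(t)| ≥ c for all t in a neighborhood of [L,Λ], where σ̄ = σ/4. -/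
open Real Set

lemma step_aux (m r R : ℝ) (hr : 0 < r) (hR : r < R) :
    ∃ φ ψ : ℝ → ℝ, ContDiff ℝ (⊤ : ℕ∞) φ ∧ (∀ t, HasDerivAt φ (-ψ t) t) ∧
      (∀ t, 0 ≤ ψ t) ∧ (∀ t, ψ t ≤ 1 / (2 * r)) ∧ (∀ t, t ≤ m - R → φ t = 1) ∧
      (∀ t, m + R ≤ t → φ t = 0) ∧ (∀ t, 0 ≤ φ t) ∧ (∀ t, φ t ≤ 1) := by
  let f : ContDiffBump m := ⟨r, R, hr, hR⟩
  let g : ℝ → ℝ := f.normed MeasureTheory.volume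
  have hgc : Continuous g := f.continuous_normed
  have hg0 : ∀ t, 0 ≤ g t := fun t => f.nonneg_normed t
  have hgs : ContDiff ℝ (⊤ : ℕ∞) g := f.contDiff_normed
  have hgb : ∀ t, g t ≤ 1 / (2 * r) := by
    intro t
    have h := f.normed_le_div_measure_closedBall_rIn MeasureTheory.volume t
    have h2 : MeasureTheory.volume.real (Metric.closedBall m f.rIn) = 2 * r := by
      rw [Real.volume_real_closedBall hr.le]
    rwa [h2] at h
  have hsupp : Function.support g = Ioo (m - R) (m + R) := by
    have : Function.support g = Metric.ball m R := f.support_normed_eq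
    rw [this, Real.ball_eq_Ioo]
  have hgone : ∫ x, g x = 1 := f.integral_normed
  let φ : ℝ → ℝ := fun t => ∫ x in t..(m + R), g x
  have hder : ∀ t, HasDerivAt φ (-g t) t := fun t =>
    intervalIntegral.integral_hasDerivAt_left (hgc.intervalIntegrable _ _)
      hgc.aestronglyMeasurable.stronglyMeasurableAtFilter hgc.continuousAt
  have h1 : ∀ t, t ≤ m - R → φ t = 1 := by
    intro t ht
    rw [← hgone]
    apply intervalIntegral.integral_eq_integral_of_support_subset
    rw [hsupp]
    intro x hx
    exact ⟨by linarith [hx.1], hx.2.le⟩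
  have h0 : ∀ t, m + R ≤ t → φ t = 0 := by
    intro t ht
    have : ∀ x ∈ uIcc t (m + R), g x = 0 := by
      intro x hx
      rw [uIcc_of_ge ht] at hx
      by_contra hne
      have : x ∈ Function.support g := hne
      rw [hsupp] at this
      linarith [this.2, hx.1]
    show ∫ x in t..(m + R), g x = 0
    rw [intervalIntegral.integral_congr (g := fun _ => (0:ℝ)) this]
    simp
  have hanti : Antitone φ := antitone_of_hasDerivAt_nonpos hder (fun t => by
    have := hg0 t
    simpa using this)
  refine ⟨φ, g, ?_, hder, hg0, hgb, h1, h0, ?_, ?_⟩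
  · have hd : deriv φ = fun t => - g t := funext fun t => (hder t).deriv
    rw [contDiff_infty_iff_deriv, hd]
    exact ⟨fun t => (hder t).differentiableAt, hgs.neg⟩
  · intro t
    have := hanti (le_max_left t (m + R))
    rw [h0 _ (le_max_right t (m + R))] at this
    exact this
  · intro t
    have := hanti (min_le_left t (m - R))
    rw [h1 _ (min_le_right t (m - R))] at this
    exact this

/-- Lemma on the existence of a suitable potential function: if `Λ > π/√(n̄σ)` (with
`n̄ = n/(n−1)`, `σ̄ = σ/4`), there exist `ω > 0`, `L ∈ (0,Λ)`, a constant `Y₀` with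
`Y₀² > ω/4`, a constant `c > 0`, and a smooth function `Y : (0,∞) → [0,∞)` such that
`Y = 0` near `[Λ,∞)`, `Y = Y₀` near `(0,L]`, and
`(n̄σ̄ω/(1+ω))·L² + Y(t)² − L·|Y'(t)| ≥ c` on a neighborhood of `[L,Λ]`. -/
theorem stmt4 (n : ℕ) (hn : 2 ≤ n) (σ Λ : ℝ) (hσ : 0 < σ)
    (hΛ : π / Real.sqrt (((n : ℝ) / ((n : ℝ) - 1)) * σ) < Λ) :
    ∃ (ω L Y₀ c : ℝ) (Y : ℝ → ℝ),
      0 < ω ∧ 0 < L ∧ L < Λ ∧ ω / 4 < Y₀ ^ 2 ∧ 0 < c ∧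
      ContDiffOn ℝ (⊤ : ℕ∞) Y (Ioi 0) ∧ (∀ t ∈ Ioi (0 : ℝ), 0 ≤ Y t) ∧
      (∃ ε > 0, ∀ t, Λ - ε < t → Y t = 0) ∧
      (∃ ε > 0, ∀ t ∈ Ioo (0 : ℝ) (L + ε), Y t = Y₀) ∧
      (∃ ε > 0, ∀ t ∈ Ioo (L - ε) (Λ + ε),
        c ≤ ((n : ℝ) / ((n : ℝ) - 1)) * (σ / 4) * (ω / (1 + ω)) * L ^ 2
              + (Y t) ^ 2 - L * |deriv Y t|) := by
  have hn1 : (0:ℝ) < (n:ℝ) - 1 := by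
    have : (2:ℝ) ≤ n := by exact_mod_cast hn
    linarith
  have hn0 : (0:ℝ) < n := by linarith
  set N : ℝ := (n : ℝ) / ((n : ℝ) - 1) with hN
  have hNpos : 0 < N := div_pos hn0 hn1
  have hNs : 0 < N * σ := mul_pos hNpos hσ
  set q := Real.sqrt (N * σ) with hq
  have hqpos : 0 < q := Real.sqrt_pos.mpr hNs
  have hq2 : q ^ 2 = N * σ := Real.sq_sqrt hNs.le
  obtain ⟨b, hb⟩ : ∃ b, b = π / q := ⟨_, rfl⟩
  have hbpos : 0 < b := hb ▸ div_pos pi_pos hqpos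
  have hqb : q * b = π := by rw [hb]; field_simp
  rw [← hb] at hΛ
  obtain ⟨d, hd⟩ : ∃ d, d = (Λ - b) / 4 := ⟨_, rfl⟩
  have hdpos : 0 < d := by rw [hd]; linarith
  have hΛe : Λ = b + 4 * d := by rw [hd]; ring
  obtain ⟨s, hs⟩ : ∃ s, s = b / (b + d) := ⟨_, rfl⟩
  have hspos : 0 < s := by rw [hs]; positivity
  have hs1 : s < 1 := by rw [hs, div_lt_one (by positivity)]; linarith
  have hs2 : 0 < 1 - s ^ 2 := by nlinarith
  obtain ⟨ω, hω⟩ : ∃ ω, ω = s ^ 2 / (1 - s ^ 2) := ⟨_, rfl⟩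
  have hωpos : 0 < ω := by rw [hω]; positivity
  have hωs : ω / (1 + ω) = s ^ 2 := by
    have : 1 + ω = 1 / (1 - s ^ 2) := by rw [hω]; field_simp; ring
    rw [this, hω]; field_simp
  obtain ⟨a, ha⟩ : ∃ a, a = π / (2 * (b + d)) := ⟨_, rfl⟩
  have hapos : 0 < a := by rw [ha]; positivity
  have hKa : N * (σ / 4) * (ω / (1 + ω)) = a ^ 2 := by
    have : a = q * s / 2 := by rw [ha, hs, ← hqb]; field_simp
    rw [hωs, this]
    linear_combination (-(s ^ 2) / 4) * hq2
  obtain ⟨A, hA⟩ : ∃ A, A = a * d := ⟨_, rfl⟩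
  have hApos : 0 < A := by rw [hA]; positivity
  obtain ⟨θ, hθ⟩ : ∃ θ, θ = arctan (Real.sqrt ω / A) := ⟨_, rfl⟩
  have hθpos : 0 < θ := by rw [hθ]; exact Real.arctan_pos.mpr (div_pos (Real.sqrt_pos.mpr hωpos) hApos)
  have hθlt : θ < π / 2 := by rw [hθ]; exact Real.arctan_lt_pi_div_two _
  have hθtan : A * tan θ = Real.sqrt ω := by rw [hθ, Real.tan_arctan]; field_simp
  obtain ⟨k, hk⟩ : ∃ k, k = θ / (b + d) := ⟨_, rfl⟩
  have hka : k < a := by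
    have : a = (π / 2) / (b + d) := by rw [ha]; field_simp
    rw [hk, this]
    gcongr
  obtain ⟨φ, ψ, hφs, hφd, hψ0, hψb, hφ1, hφ0, hφnn, hφle⟩ :=
    step_aux ((Λ + d) / 2) ((b + d) / 2) ((b + 2 * d) / 2) (by positivity) (by linarith)
  have hr0 : ∀ t, 0 ≤ θ * φ t := fun t => mul_nonneg hθpos.le (hφnn t)
  have hr1 : ∀ t, θ * φ t < π / 2 := fun t => by nlinarith [hφle t]
  have hcos : ∀ t, 0 < cos (θ * φ t) := fun t =>
    Real.cos_pos_of_mem_Ioo ⟨by linarith [hr0 t, pi_pos], hr1 t⟩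
  have hYs : ContDiff ℝ (⊤ : ℕ∞) (fun t => A * tan (θ * φ t)) := by
    have h : (fun t => A * tan (θ * φ t)) =
        fun t => A * (sin (θ * φ t) / cos (θ * φ t)) := by
      funext t; rw [Real.tan_eq_sin_div_cos]
    rw [h]
    have h2 : ContDiff ℝ (⊤ : ℕ∞) (fun t => θ * φ t) := contDiff_const.mul hφs
    exact contDiff_const.mul (h2.sin.div h2.cos (fun t => (hcos t).ne'))
  have hYd : ∀ t, HasDerivAt (fun t => A * tan (θ * φ t))
      (A * (1 / cos (θ * φ t) ^ 2 * (θ * (-ψ t)))) t := by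
    intro t
    have h1 : HasDerivAt tan (1 / cos (θ * φ t) ^ 2) (θ * φ t) :=
      Real.hasDerivAt_tan (hcos t).ne'
    have h2 : HasDerivAt (fun t => θ * φ t) (θ * (-ψ t)) t := (hφd t).const_mul θ
    exact (HasDerivAt.comp t h1 h2).const_mul A
  refine ⟨ω, d, Real.sqrt ω, A * d * (a - k), fun t => A * tan (θ * φ t), hωpos, hdpos,
    by linarith, ?_, ?_, hYs.contDiffOn, ?_, ⟨d / 2, by positivity, ?_⟩,
    ⟨d / 2, by positivity, ?_⟩, ⟨1, one_pos, ?_⟩⟩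
  · rw [Real.sq_sqrt hωpos.le]; linarith
  · exact mul_pos (mul_pos hApos hdpos) (by linarith)
  · intro t _
    exact mul_nonneg hApos.le
      (Real.tan_nonneg_of_nonneg_of_le_pi_div_two (hr0 t) (hr1 t).le)
  · intro t ht
    have := hφ0 t (by linarith)
    simp [this]
  · intro t ht
    have := hφ1 t (by linarith [ht.2])
    simp only [this, mul_one, hθtan]
  · intro t _
    rw [(hYd t).deriv, hKa]
    have hc := hcos t
    have hk2 : θ * ψ t ≤ k := by
      have h := mul_le_mul_of_nonneg_left (hψb t) hθpos.le
      have e : θ * (1 / (2 * ((b + d) / 2))) = k := by rw [hk]; field_simp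
      linarith
    have hpn : 0 ≤ θ * ψ t := mul_nonneg hθpos.le (hψ0 t)
    obtain ⟨S, hS⟩ : ∃ S, S = 1 / cos (θ * φ t) ^ 2 := ⟨_, rfl⟩
    have hS1 : 1 ≤ S := by
      rw [hS, le_div_iff₀ (by positivity)]
      nlinarith [Real.cos_le_one (θ * φ t)]
    have htan : tan (θ * φ t) ^ 2 = S - 1 := by
      rw [hS, Real.tan_eq_sin_div_cos]
      have := Real.sin_sq_add_cos_sq (θ * φ t)
      field_simp
      linarith
    have habs : |A * (1 / cos (θ * φ t) ^ 2 * (θ * (-ψ t)))| = A * (S * (θ * ψ t)) := by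
      rw [← hS, show A * (S * (θ * (-ψ t))) = -(A * (S * (θ * ψ t))) by ring, abs_neg,
        abs_of_nonneg]
      positivity
    rw [habs, mul_pow, htan]
    have e : a ^ 2 * d ^ 2 + A ^ 2 * (S - 1) - d * (A * (S * (θ * ψ t)))
        = A * d * (S * (a - θ * ψ t)) := by rw [hA]; ring
    rw [e]
    have : a - k ≤ S * (a - θ * ψ t) := by
      have h1 : 0 ≤ a - θ * ψ t := by linarith
      have h2 := le_mul_of_one_le_left h1 hS1
      linarith
    have hAd : 0 ≤ A * d := by positivity
    exact mul_le_mul_of_nonneg_left this hAd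
end

section
/- Let σ > 0, n ≥ 2, n̄ = n/(n−1), σ̄ = σ/4, and suppose Λ > π/√(n̄σ). Then there exist a constant ω > 0, a constant c > 0, and smooth functions Z : (0,∞) → (0,1] and Y : (0,∞) → [0,∞) such that: Z(t) = d√t near 0 for some d > 0; Z is constant on a neighborhood of [Λ,∞); Y is constant near 0; Y = 0 on a neighborhood of [Λ,∞); and for all t > 0, (n̄σ̄ω/(1+ω))·Z(t)⁴ − ω·Z(t)²·|Z'(t)|² + Y(t)² − Z(t)²·|Y'(t)| ≥ c. -/
open Real Set

/-- The profile: `W' = φ`, `φ' = -p`, `0 ≤ p ≤ κ W` with `κ < s²`. -/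
lemma profile_exists (s Λ : ℝ) (hs : 0 < s) (hΛ : 0 < Λ) (hsΛ : π / 2 < s * Λ) :
    ∃ (W φ p : ℝ → ℝ) (κ ε L : ℝ), 0 < κ ∧ κ < s ^ 2 ∧ 0 < ε ∧ ε < L ∧ L < Λ ∧
      ContDiff ℝ (⊤ : ℕ∞) W ∧ ContDiff ℝ (⊤ : ℕ∞) φ ∧
      (∀ t, HasDerivAt W (φ t) t) ∧ (∀ t, HasDerivAt φ (-p t) t) ∧
      (∀ t, 0 ≤ p t) ∧ (∀ t, 0 < t → p t ≤ κ * W t) ∧ (∀ t, 0 ≤ φ t) ∧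
      (∀ t, L ≤ t → φ t = 0) ∧ (∀ t, t ≤ ε → φ t = φ 0) ∧ 0 < φ 0 ∧ W 0 = 0 := by
  have hpi := Real.pi_pos
  obtain ⟨β, hβ1, hβ2⟩ : ∃ β, π / (2 * Λ) < β ∧ β < min s (π / Λ) := by
    apply exists_between
    apply lt_min
    · rw [div_lt_iff₀ (by positivity)]; linarith
    · rw [div_lt_div_iff₀ (by positivity) hΛ]; nlinarith
  have hβs : β < s := lt_of_lt_of_le hβ2 (min_le_left _ _)
  have hβπ : β < π / Λ := lt_of_lt_of_le hβ2 (min_le_right _ _)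
  have hβ : 0 < β := lt_trans (by positivity) hβ1
  rw [div_lt_iff₀ (by positivity)] at hβ1
  rw [lt_div_iff₀ hΛ] at hβπ
  obtain ⟨q, hq1, hq2⟩ : ∃ q, β ^ 2 / s ^ 2 < q ∧ q < 1 := by
    apply exists_between
    rw [div_lt_one (by positivity)]
    nlinarith
  have hq : 0 < q := lt_trans (by positivity) hq1
  set L1 : ℝ := π / (2 * β) with hL1
  have hL1β : β * L1 = π / 2 := by rw [hL1]; field_simp
  have hL1pos : 0 < L1 := by positivity
  have hL1Λ : L1 < Λ := by
    rw [hL1, div_lt_iff₀ (by positivity)]; linarith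
  set L : ℝ := (L1 + Λ) / 2 with hL
  have hL1L : L1 < L := by rw [hL]; linarith
  have hLΛ : L < Λ := by rw [hL]; linarith
  set ε : ℝ := Real.arccos q / (2 * β) with hε
  have hεpos : 0 < ε := by
    have : 0 < Real.arccos q := Real.arccos_pos.2 hq2
    positivity
  have hεβ : β * (2 * ε) = Real.arccos q := by rw [hε]; field_simp
  have hεL1 : 2 * ε < L1 := by
    have : Real.arccos q < π / 2 := Real.arccos_lt_pi_div_two.2 hq
    by_contra h
    push Not at h
    nlinarith
  set χ : ℝ → ℝ := fun t => Real.smoothTransition (t / ε - 1) *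
    Real.smoothTransition ((L - t) / (L - L1)) with hχ
  have hχ0 : ∀ t, 0 ≤ χ t := fun t =>
    mul_nonneg (Real.smoothTransition.nonneg _) (Real.smoothTransition.nonneg _)
  have hχ1 : ∀ t, χ t ≤ 1 := fun t =>
    mul_le_one₀ (Real.smoothTransition.le_one _) (Real.smoothTransition.nonneg _)
      (Real.smoothTransition.le_one _)
  have hχl : ∀ t, t ≤ ε → χ t = 0 := by
    intro t ht
    have : t / ε - 1 ≤ 0 := by
      have := (div_le_one hεpos).2 ht
      linarith
    simp only [hχ, Real.smoothTransition.zero_of_nonpos this, zero_mul]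
  have hχr : ∀ t, L ≤ t → χ t = 0 := by
    intro t ht
    have : (L - t) / (L - L1) ≤ 0 :=
      div_nonpos_of_nonpos_of_nonneg (by linarith) (by linarith)
    simp only [hχ, Real.smoothTransition.zero_of_nonpos this, mul_zero]
  have hχm : ∀ t, 2 * ε ≤ t → t ≤ L1 → χ t = 1 := by
    intro t h1 h2
    have e1 : 1 ≤ t / ε - 1 := by
      have := (le_div_iff₀ hεpos).2 h1
      linarith
    have e2 : 1 ≤ (L - t) / (L - L1) := by
      rw [le_div_iff₀ (by linarith)]; linarith
    simp only [hχ, Real.smoothTransition.one_of_one_le e1,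
      Real.smoothTransition.one_of_one_le e2, mul_one]
  have hχs : ContDiff ℝ (⊤ : ℕ∞) χ := by
    apply ContDiff.mul
    · exact Real.smoothTransition.contDiff.comp (by fun_prop)
    · exact Real.smoothTransition.contDiff.comp (by fun_prop)
  set p : ℝ → ℝ := fun t => β * χ t * Real.sin (β * t) with hp
  have hps : ContDiff ℝ (⊤ : ℕ∞) p := by
    apply ContDiff.mul (contDiff_const.mul hχs)
    exact Real.contDiff_sin.comp (by fun_prop)
  have hpc : Continuous p := hps.continuous
  have hsin : ∀ t, 0 ≤ t → t ≤ L → 0 ≤ Real.sin (β * t) := by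
    intro t h0 h1
    apply Real.sin_nonneg_of_nonneg_of_le_pi (by positivity)
    nlinarith
  have hp0 : ∀ t, 0 ≤ p t := by
    intro t
    simp only [hp]
    rcases le_total t ε with h | h
    · simp [hχl t h]
    rcases le_total L t with h' | h'
    · simp [hχr t h']
    · exact mul_nonneg (mul_nonneg hβ.le (hχ0 t)) (hsin t (by linarith) h')
  set φ : ℝ → ℝ := fun t => - ∫ x in L..t, p x with hφ
  have hφd : ∀ t, HasDerivAt φ (-p t) t := fun t =>
    (intervalIntegral.integral_hasDerivAt_right (hpc.intervalIntegrable _ _)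
      (hpc.stronglyMeasurableAtFilter _ _) hpc.continuousAt).neg
  have smooth_of : ∀ f g : ℝ → ℝ, (∀ t, HasDerivAt f (g t) t) → ContDiff ℝ (⊤ : ℕ∞) g →
      ContDiff ℝ (⊤ : ℕ∞) f := by
    intro f g h hg
    rw [contDiff_infty_iff_deriv]
    refine ⟨fun t => (h t).differentiableAt, ?_⟩
    rwa [show deriv f = g from funext fun t => (h t).deriv]
  have hφs : ContDiff ℝ (⊤ : ℕ∞) φ := smooth_of φ (fun t => -p t) hφd hps.neg
  have hφc : Continuous φ := hφs.continuous
  have hφanti : Antitone φ := by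
    apply antitone_of_deriv_nonpos (fun t => (hφd t).differentiableAt)
    intro t
    rw [(hφd t).deriv]
    linarith [hp0 t]
  have hφL : φ L = 0 := by simp [hφ]
  have hφr : ∀ t, L ≤ t → φ t = 0 := by
    intro t ht
    have : ∫ x in L..t, p x = ∫ x in L..t, (0 : ℝ) := by
      apply intervalIntegral.integral_congr
      intro x hx
      rw [uIcc_of_le ht] at hx
      simp [hp, hχr x hx.1]
    simp only [hφ, this]
    simp
  have hφ0 : ∀ t, 0 ≤ φ t := by
    intro t
    rcases le_total t L with h | h
    · rw [← hφL]; exact hφanti h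
    · rw [hφr t h]
  have hφl : ∀ t, t ≤ ε → φ t = φ 0 := by
    intro t ht
    have h : ∫ x in (0:ℝ)..t, p x = ∫ x in (0:ℝ)..t, (0 : ℝ) := by
      apply intervalIntegral.integral_congr
      intro x hx
      have : x ≤ ε := hx.2.trans (max_le hεpos.le ht)
      simp [hp, hχl x this]
    have h2 := intervalIntegral.integral_add_adjacent_intervals
      (hpc.intervalIntegrable (μ := MeasureTheory.volume) L 0) (hpc.intervalIntegrable 0 t)
    rw [h] at h2
    simp only [hφ, ← h2]
    simp
  -- lower bound for φ
  have hφcos : ∀ t, 2 * ε ≤ t → t ≤ L1 → Real.cos (β * t) ≤ φ t := by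
    intro t h1 h2
    have hd : ∀ x, HasDerivAt (fun x => φ x - Real.cos (β * x))
        (-p x - (-Real.sin (β * x) * β)) x := by
      intro x
      have := ((hasDerivAt_id x).const_mul β).cos
      simp only [id, mul_one] at this
      exact (hφd x).sub this
    have hanti : AntitoneOn (fun x => φ x - Real.cos (β * x)) (Icc (2 * ε) L1) := by
      apply antitoneOn_of_deriv_nonpos (convex_Icc _ _)
      · exact fun x _ => (hd x).continuousAt.continuousWithinAt
      · exact fun x _ => (hd x).differentiableAt.differentiableWithinAt
      · intro x hx
        rw [interior_Icc] at hx
        rw [(hd x).deriv]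
        simp only [hp, hχm x hx.1.le hx.2.le]
        linarith
    have := hanti (⟨h1, h2⟩ : t ∈ Icc (2 * ε) L1) ⟨hεL1.le, le_rfl⟩ h2
    simp only [hL1β, Real.cos_pi_div_two] at this
    linarith [hφ0 L1]
  have hφ2ε : q ≤ φ (2 * ε) := by
    have := hφcos (2 * ε) le_rfl hεL1.le
    rwa [hεβ, Real.cos_arccos (by linarith) hq2.le] at this
  have hφq : ∀ t, 0 ≤ t → t ≤ L1 → q * Real.cos (β * t) ≤ φ t := by
    intro t h0 h1
    rcases le_total t (2 * ε) with h | h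
    · have := hφanti h
      have := Real.cos_le_one (β * t)
      nlinarith
    · have hc : 0 ≤ Real.cos (β * t) := by
        apply Real.cos_nonneg_of_neg_pi_div_two_le_of_le
        · have : 0 ≤ β * t := by positivity
          linarith
        · rw [← hL1β]; gcongr
      have := hφcos t h h1
      nlinarith
  set W : ℝ → ℝ := fun t => ∫ x in (0:ℝ)..t, φ x with hW
  have hWd : ∀ t, HasDerivAt W (φ t) t := fun t =>
    intervalIntegral.integral_hasDerivAt_right (hφc.intervalIntegrable _ _)
      (hφc.stronglyMeasurableAtFilter _ _) hφc.continuousAt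
  have hWs : ContDiff ℝ (⊤ : ℕ∞) W := smooth_of W φ hWd hφs
  have hW0 : W 0 = 0 := by simp [hW]
  have hWmono : Monotone W := by
    apply monotone_of_deriv_nonneg (fun t => (hWd t).differentiableAt)
    intro t
    rw [(hWd t).deriv]
    exact hφ0 t
  have hWsin1 : ∀ t, 0 ≤ t → t ≤ L1 → q / β * Real.sin (β * t) ≤ W t := by
    intro t h1 h2
    have hd : ∀ x, HasDerivAt (fun x => W x - q / β * Real.sin (β * x))
        (φ x - q / β * (Real.cos (β * x) * β)) x := by
      intro x
      have := ((hasDerivAt_id x).const_mul β).sin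
      simp only [id, mul_one] at this
      exact (hWd x).sub (this.const_mul _)
    have hmono : MonotoneOn (fun x => W x - q / β * Real.sin (β * x)) (Icc 0 L1) := by
      apply monotoneOn_of_deriv_nonneg (convex_Icc _ _)
      · exact fun x _ => (hd x).continuousAt.continuousWithinAt
      · exact fun x _ => (hd x).differentiableAt.differentiableWithinAt
      · intro x hx
        rw [interior_Icc] at hx
        rw [(hd x).deriv]
        have := hφq x hx.1.le hx.2.le
        have e : q / β * (Real.cos (β * x) * β) = q * Real.cos (β * x) := by field_simp
        rw [e]; linarith
    have := hmono (⟨le_rfl, hL1pos.le⟩ : (0:ℝ) ∈ Icc 0 L1) ⟨h1, h2⟩ h1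
    simp only [hW0, mul_zero, Real.sin_zero] at this
    linarith
  have hWsin : ∀ t, 0 ≤ t → q / β * Real.sin (β * t) ≤ W t := by
    intro t h
    rcases le_total t L1 with h' | h'
    · exact hWsin1 t h h'
    · have h1 := hWsin1 L1 hL1pos.le le_rfl
      rw [hL1β, Real.sin_pi_div_two] at h1
      have h2 := hWmono h'
      have h3 : q / β * Real.sin (β * t) ≤ q / β * 1 := by
        gcongr
        exact Real.sin_le_one _
      linarith
  refine ⟨W, φ, p, β ^ 2 / q, ε, L, by positivity, ?_, hεpos, by linarith, hLΛ, hWs, hφs, hWd,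
    hφd, hp0, ?_, hφ0, hφr, hφl, ?_, hW0⟩
  · rw [div_lt_iff₀ (by positivity)] at hq1 ⊢
    linarith
  · intro t ht
    have hWt : 0 ≤ W t := by rw [← hW0]; exact hWmono ht.le
    rcases le_total L t with h | h
    · simp only [hp, hχr t h]
      have : 0 ≤ β ^ 2 / q * W t := by positivity
      simpa using this
    · have hsn := hsin t ht.le h
      have h1 := hWsin t ht.le
      calc p t ≤ β * 1 * Real.sin (β * t) := by
            simp only [hp]
            gcongr
            exact hχ1 t
        _ = β ^ 2 / q * (q / β * Real.sin (β * t)) := by field_simp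
        _ ≤ β ^ 2 / q * W t := by gcongr
  · have := hφanti (show (0:ℝ) ≤ 2 * ε by linarith)
    linarith

theorem stmt5 (n : ℕ) (hn : 2 ≤ n) (σ Λ : ℝ) (hσ : 0 < σ)
    (hΛ : π / Real.sqrt (((n : ℝ) / ((n : ℝ) - 1)) * σ) < Λ) :
    ∃ (ω c : ℝ) (Z Y : ℝ → ℝ),
      0 < ω ∧ 0 < c ∧
      ContDiffOn ℝ (⊤ : ℕ∞) Z (Ioi 0) ∧ ContDiffOn ℝ (⊤ : ℕ∞) Y (Ioi 0) ∧
      (∀ t ∈ Ioi (0 : ℝ), 0 < Z t ∧ Z t ≤ 1) ∧ (∀ t ∈ Ioi (0 : ℝ), 0 ≤ Y t) ∧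
      (∃ d > 0, ∃ ε > 0, ∀ t ∈ Ioo (0 : ℝ) ε, Z t = d * Real.sqrt t) ∧
      (∃ ε > 0, ∃ z₀ : ℝ, ∀ t, Λ - ε < t → Z t = z₀) ∧
      (∃ ε > 0, ∃ y₀ : ℝ, ∀ t ∈ Ioo (0 : ℝ) ε, Y t = y₀) ∧
      (∃ ε > 0, ∀ t, Λ - ε < t → Y t = 0) ∧
      (∀ t ∈ Ioi (0 : ℝ),
        c ≤ ((n : ℝ) / ((n : ℝ) - 1)) * (σ / 4) * (ω / (1 + ω)) * (Z t) ^ 4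
              - ω * (Z t) ^ 2 * |deriv Z t| ^ 2 + (Y t) ^ 2 - (Z t) ^ 2 * |deriv Y t|) := by
  have hn' : (2 : ℝ) ≤ n := by exact_mod_cast hn
  have hN : 0 < (n : ℝ) / ((n : ℝ) - 1) := div_pos (by linarith) (by linarith)
  set N : ℝ := (n : ℝ) / ((n : ℝ) - 1) with hNdef
  have hpi := Real.pi_pos
  have hr : 0 < Real.sqrt (N * σ) := Real.sqrt_pos.2 (by positivity)
  have hΛ0 : 0 < Λ := lt_trans (by positivity) hΛ
  rw [div_lt_iff₀ hr] at hΛ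
  obtain ⟨W, φ, p, κ, ε, L, hκ, hκs, hε, hεL, hLΛ, hWs, hφs, hWd, hφd, hp0, hpW, hφ0, hφr, hφl,
    hφ00, hW0⟩ := profile_exists (Real.sqrt (N * σ) / 2) Λ (by positivity) hΛ0 (by linarith)
  have hs2 : (Real.sqrt (N * σ) / 2) ^ 2 = N * (σ / 4) := by
    rw [div_pow, Real.sq_sqrt (by positivity)]; ring
  rw [hs2] at hκs
  set a : ℝ := N * (σ / 4) with ha
  have hWmono : Monotone W := by
    apply monotone_of_deriv_nonneg (fun t => (hWd t).differentiableAt)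
    intro t
    rw [(hWd t).deriv]
    exact hφ0 t
  have hWl : ∀ t, 0 ≤ t → t ≤ ε → W t = φ 0 * t := by
    intro t h0 h1
    have hd : ∀ x, HasDerivAt (fun x => W x - φ 0 * x) (φ x - φ 0 * 1) x := fun x =>
      (hWd x).sub ((hasDerivAt_id x).const_mul _)
    have := constant_of_has_deriv_right_zero (f := fun x => W x - φ 0 * x) (a := 0) (b := ε)
      (fun x _ => (hd x).continuousAt.continuousWithinAt)
      (fun x hx => by
        have := (hd x).hasDerivWithinAt (s := Ici x)
        rwa [hφl x hx.2.le, mul_one, sub_self] at this) t ⟨h0, h1⟩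
    simp only [hW0] at this
    linarith
  have hWr : ∀ t, L ≤ t → W t = W L := by
    intro t h0
    exact constant_of_has_deriv_right_zero (f := W) (a := L) (b := t)
      (fun x _ => (hWd x).continuousAt.continuousWithinAt)
      (fun x hx => by
        have := (hWd x).hasDerivWithinAt (s := Ici x)
        rwa [hφr x hx.1] at this) t ⟨h0, le_rfl⟩
  have hWε : W ε = φ 0 * ε := hWl ε hε.le le_rfl
  have hWεpos : 0 < W ε := by rw [hWε]; positivity
  have hWpos : ∀ t, 0 < t → 0 < W t := by
    intro t ht
    rcases le_total t ε with h | h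
    · rw [hWl t ht.le h]; positivity
    · exact lt_of_lt_of_le hWεpos (hWmono h)
  have hWL : 0 < W L := hWpos L (by linarith)
  have hWle : ∀ t, W t ≤ W L := by
    intro t
    rcases le_total t L with h | h
    · exact hWmono h
    · exact (hWr t h).le
  set l : ℝ := (W L)⁻¹ with hl
  have hlpos : 0 < l := by positivity
  obtain ⟨m, hm1, hm2⟩ : ∃ m, 1 / 2 < m ∧ m < a / (2 * κ) := by
    apply exists_between
    rw [div_lt_div_iff₀ (by positivity) (by positivity)]
    linarith
  have hm0 : 0 < m := by linarith
  rw [lt_div_iff₀ (by positivity)] at hm2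
  have hA : 0 < a / 2 - m * κ := by linarith
  have hB : 0 < m ^ 2 - 1 / 4 := by nlinarith
  have hYd : ∀ t, HasDerivAt (fun t => m * l * φ t) (m * l * (-p t)) t := fun t =>
    (hφd t).const_mul _
  have hZd : ∀ t, 0 < t → HasDerivAt (fun t => Real.sqrt (l * W t))
      (l * φ t / (2 * Real.sqrt (l * W t))) t := fun t ht =>
    ((hWd t).const_mul l).sqrt (mul_pos hlpos (hWpos t ht)).ne'
  refine ⟨1, l ^ 2 * min ((m ^ 2 - 1 / 4) * φ 0 ^ 2) ((a / 2 - m * κ) * W ε ^ 2),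
    fun t => Real.sqrt (l * W t), fun t => m * l * φ t, one_pos, ?_, ?_, ?_, ?_, ?_, ?_, ?_, ?_,
    ?_, ?_⟩
  · have : 0 < min ((m ^ 2 - 1 / 4) * φ 0 ^ 2) ((a / 2 - m * κ) * W ε ^ 2) :=
      lt_min (by positivity) (by positivity)
    positivity
  · apply ContDiffOn.sqrt
    · exact (contDiff_const.mul hWs).contDiffOn
    · intro t ht
      exact (mul_pos hlpos (hWpos t ht)).ne'
  · exact (contDiff_const.mul hφs).contDiffOn
  · intro t ht
    refine ⟨Real.sqrt_pos.2 (mul_pos hlpos (hWpos t ht)), ?_⟩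
    rw [Real.sqrt_le_one]
    calc l * W t ≤ l * W L := by gcongr; exact hWle t
      _ = 1 := inv_mul_cancel₀ hWL.ne'
  · intro t _
    have := hφ0 t
    positivity
  · refine ⟨Real.sqrt (l * φ 0), Real.sqrt_pos.2 (by positivity), ε, hε, ?_⟩
    intro t ht
    simp only
    rw [hWl t ht.1.le ht.2.le, ← mul_assoc, Real.sqrt_mul (by positivity)]
  · refine ⟨Λ - L, by linarith, Real.sqrt (l * W L), ?_⟩
    intro t ht
    simp only
    rw [hWr t (by linarith)]
  · refine ⟨ε, hε, m * l * φ 0, ?_⟩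
    intro t ht
    simp only
    rw [hφl t ht.2.le]
  · refine ⟨Λ - L, by linarith, ?_⟩
    intro t ht
    simp only
    rw [hφr t (by linarith), mul_zero]
  · intro t ht
    have ht' : 0 < t := ht
    have hWt := hWpos t ht'
    have hpt := hp0 t
    rw [(hZd t ht').deriv, (hYd t).deriv]
    have hz : 0 < Real.sqrt (l * W t) := Real.sqrt_pos.2 (mul_pos hlpos hWt)
    have hz2 : Real.sqrt (l * W t) ^ 2 = l * W t := Real.sq_sqrt (by positivity)
    have hz4 : Real.sqrt (l * W t) ^ 4 = (l * W t) ^ 2 := by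
      calc Real.sqrt (l * W t) ^ 4 = (Real.sqrt (l * W t) ^ 2) ^ 2 := by ring
        _ = (l * W t) ^ 2 := by rw [hz2]
    have e1 : 1 * Real.sqrt (l * W t) ^ 2 * |l * φ t / (2 * Real.sqrt (l * W t))| ^ 2
        = l ^ 2 * φ t ^ 2 / 4 := by
      rw [sq_abs]; field_simp; ring
    have e2 : |m * l * (-p t)| = m * l * p t := by
      rw [mul_neg, abs_neg, abs_of_nonneg (by positivity)]
    rw [e1, e2, hz4, hz2]
    have key : min ((m ^ 2 - 1 / 4) * φ 0 ^ 2) ((a / 2 - m * κ) * W ε ^ 2) ≤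
        (a / 2 - m * κ) * W t ^ 2 + (m ^ 2 - 1 / 4) * φ t ^ 2 := by
      rcases le_total t ε with h | h
      · rw [hφl t h]
        have : 0 ≤ (a / 2 - m * κ) * W t ^ 2 := by positivity
        exact (min_le_left _ _).trans (by linarith)
      · have h1 := hWmono h
        have : (a / 2 - m * κ) * W ε ^ 2 ≤ (a / 2 - m * κ) * W t ^ 2 := by gcongr
        have : 0 ≤ (m ^ 2 - 1 / 4) * φ t ^ 2 := by positivity
        exact (min_le_right _ _).trans (by linarith)
    have h3 : m * W t * p t ≤ m * W t * (κ * W t) := by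
      gcongr
      exact hpW t ht'
    calc l ^ 2 * min ((m ^ 2 - 1 / 4) * φ 0 ^ 2) ((a / 2 - m * κ) * W ε ^ 2)
        ≤ l ^ 2 * (a / 2 * W t ^ 2 + (m ^ 2 - 1 / 4) * φ t ^ 2 - m * W t * p t) := by
          gcongr
          linarith
      _ = _ := by ring
end
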